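/- Let 0 < τ < ∞ and for ε ∈ (0,1] let f_ε = 1_{[0,ε]×[0,1]} be the characteristic function of the rectangle [0,ε]×[0,1] ⊆ ℝ². Then there are constants c₁, c₂ > 0, depending only on τ, such that for all t > 0 and all ε ∈ (0,1]: c₁ · min(t, ε) ≤ ω₁(f_ε, t)_τ^τ ≤ c₂ · min(t, ε), i.e. the first modulus of smoothness satisfies ω₁(f_ε,t)_τ^τ ∼ t for t ≤ ε and ω₁(f_ε,t)_τ^τ ∼ ε for t > ε. -/

import Mathlib

open scoped Classical

open Set Metric MeasureTheory ENNReal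

noncomputable section

/-- The Euclidean plane `ℝ²`. -/
abbrev Plane : Type := EuclideanSpace ℝ (Fin 2)

/-- `Q` is a compact regular convex set whose boundary is a polygon consisting of at most
`N₀` line segments, with eccentricity bounded by `c₀`. -/
def IsRegularConvexPolygon (N₀ : ℕ) (c₀ : ℝ) (Q : Set Plane) : Prop :=
  IsCompact Q ∧ Convex ℝ Q ∧ Q.Nonempty ∧
    (∃ (m : ℕ) (v w : Fin m → Plane), m ≤ N₀ ∧ frontier Q = ⋃ i, segment ℝ (v i) (w i)) ∧
    (∃ (x₁ x₂ : Plane) (r₁ r₂ : ℝ), 0 < r₂ ∧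
      closedBall x₂ r₂ ⊆ Q ∧ Q ⊆ closedBall x₁ r₁ ∧ r₁ ≤ c₀ * r₂)

/-- There is a triangle contained in `R` having the segment `[a,b]` as a side, whose two
angles adjacent to that side are equal to `β`. -/
def HasGoodTriangle (β : ℝ) (R : Set Plane) (a b : Plane) : Prop :=
  ∃ c : Plane, convexHull ℝ {a, b, c} ⊆ R ∧
    EuclideanGeometry.angle b a c = β ∧ EuclideanGeometry.angle a b c = β

/-- `R ⊆ ℝ²` is a ring with structural parameters `N₀`, `c₀`, `β`: the difference of two
regular compact convex sets with polygonal boundaries, admitting no uncontrollably narrow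
elongated subregions (each maximal edge of the boundary can be subdivided into at most two
segments, each carrying a good triangle with adjacent angles `β` inside `R`). -/
def IsRing (N₀ : ℕ) (c₀ β : ℝ) (R : Set Plane) : Prop :=
  (∃ Q₁ Q₂ : Set Plane,
      IsRegularConvexPolygon N₀ c₀ Q₁ ∧
      (Q₂ = ∅ ∨ (Q₂ ⊆ Q₁ ∧ IsRegularConvexPolygon N₀ c₀ Q₂)) ∧
      R = Q₁ \ interior Q₂) ∧
  (∃ (m : ℕ) (v w : Fin m → Plane),
      frontier R = ⋃ i, segment ℝ (v i) (w i) ∧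
      (∀ i, ∀ a b : Plane, segment ℝ (v i) (w i) ⊆ segment ℝ a b →
        segment ℝ a b ⊆ frontier R → segment ℝ a b = segment ℝ (v i) (w i)) ∧
      (∀ i, ∃ p ∈ segment ℝ (v i) (w i),
        HasGoodTriangle β R (v i) p ∧ HasGoodTriangle β R p (w i)))

/-- `Ω` is the union of `n` rings with pairwise disjoint interiors. -/
def IsRingDecomp (N₀ : ℕ) (c₀ β : ℝ) (n : ℕ) (Ω : Set Plane) : Prop :=
  ∃ R : Fin n → Set Plane,
    (∀ j, IsRing N₀ c₀ β (R j)) ∧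
    (∀ i j, i ≠ j → interior (R i) ∩ interior (R j) = ∅) ∧
    (⋃ j, R j) = Ω

/-- Membership in the nonlinear spline class `S(n,k)`: piecewise polynomials of total degree
`< k` over `n` rings with pairwise disjoint interiors whose union is `Ω` (or, when `Ω = ℝ²`,
whose union -- the support of the spline -- is itself a ring), having maximum smoothness
`W^{k-2}(Ω)` when `k ≥ 2` (no smoothness is required for piecewise constants, `k = 1`). -/
def IsSpline (N₀ : ℕ) (c₀ β : ℝ) (n k : ℕ) (Ω : Set Plane) (S : Plane → ℝ) : Prop :=
  ∃ (R : Fin n → Set Plane) (P : Fin n → MvPolynomial (Fin 2) ℝ),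
    (∀ j, IsRing N₀ c₀ β (R j)) ∧
    (∀ i j, i ≠ j → interior (R i) ∩ interior (R j) = ∅) ∧
    ((⋃ j, R j) = Ω ∨ (Ω = Set.univ ∧ IsRing N₀ c₀ β (⋃ j, R j))) ∧
    (∀ j, (P j).totalDegree < k) ∧
    (S = fun x => ∑ j, (R j).indicator (fun y => MvPolynomial.eval (fun i => y i) (P j)) x) ∧
    (2 ≤ k → ContDiffOn ℝ ((k - 2 : ℕ) : ℕ∞) S Ω)

/-- The spline class `S(n,k,r)` with defect: smoothness `W^r(Ω)` instead of the maximal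
smoothness `W^{k-2}(Ω)`. -/
def IsSplineDefect (N₀ : ℕ) (c₀ β : ℝ) (n k r : ℕ) (Ω : Set Plane) (S : Plane → ℝ) : Prop :=
  ∃ (R : Fin n → Set Plane) (P : Fin n → MvPolynomial (Fin 2) ℝ),
    (∀ j, IsRing N₀ c₀ β (R j)) ∧
    (∀ i j, i ≠ j → interior (R i) ∩ interior (R j) = ∅) ∧
    ((⋃ j, R j) = Ω ∨ (Ω = Set.univ ∧ IsRing N₀ c₀ β (⋃ j, R j))) ∧
    (∀ j, (P j).totalDegree < k) ∧
    (S = fun x => ∑ j, (R j).indicator (fun y => MvPolynomial.eval (fun i => y i) (P j)) x) ∧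
    ContDiffOn ℝ ((r : ℕ) : ℕ∞) S Ω

/-- The `L^p(Ω)` quasi-norm, `0 < p < ∞`. -/
def lpNormE (p : ℝ) (Ω : Set Plane) (f : Plane → ℝ) : ℝ≥0∞ :=
  eLpNorm f (ENNReal.ofReal p) (volume.restrict Ω)

/-- `k`-th finite difference `Δ_h^k f(x)`, set to `0` unless the segment `[x, x+kh] ⊆ Ω`. -/
def deltah (Ω : Set Plane) (k : ℕ) (h : Plane) (f : Plane → ℝ) (x : Plane) : ℝ :=
  if segment ℝ x (x + (k : ℝ) • h) ⊆ Ω then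
    ∑ ν ∈ Finset.range (k + 1), (-1 : ℝ) ^ (k + ν) * (k.choose ν : ℝ) * f (x + (ν : ℝ) • h)
  else 0

/-- Modulus of smoothness `ω_k(f,t)_τ = sup_{|h| ≤ t} ‖Δ_h^k f‖_{L^τ(Ω)}`. -/
def modulus (Ω : Set Plane) (k : ℕ) (τ : ℝ) (f : Plane → ℝ) (t : ℝ) : ℝ≥0∞ :=
  ⨆ (h : Plane) (_ : ‖h‖ ≤ t), lpNormE τ Ω (deltah Ω k h f)

/-- Besov seminorm `|f|_{B^{s,k}_τ} = (∫₀^∞ [t^{-s} ω_k(f,t)_τ]^τ dt/t)^{1/τ}`. -/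
def besovSeminorm (Ω : Set Plane) (k : ℕ) (s τ : ℝ) (f : Plane → ℝ) : ℝ≥0∞ :=
  (∫⁻ t in Set.Ioi (0 : ℝ),
      (ENNReal.ofReal (t ^ (-s)) * modulus Ω k τ f t) ^ τ / ENNReal.ofReal t) ^ (1 / τ)

/-- Error of best `L^p(Ω)`-approximation `S_n^k(f)_p` from the spline class `S(n,k)`. -/
def splineApprox (N₀ : ℕ) (c₀ β : ℝ) (n k : ℕ) (p : ℝ) (Ω : Set Plane) (f : Plane → ℝ) :
    ℝ≥0∞ :=
  ⨅ (S : Plane → ℝ) (_ : IsSpline N₀ c₀ β n k Ω S), lpNormE p Ω fun x => f x - S x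

/-- The K-functional `K(f,t; L^p(Ω), B^{s,k}_τ)`. -/
def kFunctional (Ω : Set Plane) (k : ℕ) (s τ p : ℝ) (f : Plane → ℝ) (t : ℝ) : ℝ≥0∞ :=
  ⨅ g : Plane → ℝ,
    lpNormE p Ω (fun x => f x - g x) + ENNReal.ofReal t * besovSeminorm Ω k s τ g

/-- BV seminorm: the total mass of the distributional gradient of `g` on `Ω`, defined by
duality against compactly supported `C¹` vector fields of norm at most one. -/
def bvSeminorm (Ω : Set Plane) (g : Plane → ℝ) : ℝ≥0∞ :=
  ⨆ (φ : Plane → Plane) (_ : ContDiff ℝ 1 φ ∧ HasCompactSupport φ ∧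
      tsupport φ ⊆ interior Ω ∧ ∀ x, ‖φ x‖ ≤ 1),
    ENNReal.ofReal (∫ x in Ω, g x * ∑ i, fderiv ℝ φ x (EuclideanSpace.single i 1) i)

/-- The K-functional `K(f,t; L²(Ω), BV(Ω))`. -/
def kFunctionalBV (Ω : Set Plane) (f : Plane → ℝ) (t : ℝ) : ℝ≥0∞ :=
  ⨅ g : Plane → ℝ,
    lpNormE 2 Ω (fun x => f x - g x) + ENNReal.ofReal t * bvSeminorm Ω g

/-- The characteristic function of the rectangle `[0,ε] × [0,1] ⊆ ℝ²`. -/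
def fEps (ε : ℝ) : Plane → ℝ :=
  Set.indicator {x : Plane | x 0 ∈ Set.Icc 0 ε ∧ x 1 ∈ Set.Icc 0 1} 1

/-- The points `x` of the rectangle `[0,ε] × [0,1]` whose translate `x + h` lies outside it. -/
def exitSet (ε : ℝ) (h : Plane) : Set Plane :=
  {x | (x 0 ∈ Icc 0 ε ∧ x 1 ∈ Icc 0 1) ∧ ¬(x 0 + h 0 ∈ Icc 0 ε ∧ x 1 + h 1 ∈ Icc 0 1)}

lemma measurableSet_exitSet (ε : ℝ) (h : Plane) : MeasurableSet (exitSet ε h) := by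
  unfold exitSet
  simp only [mem_Icc]
  measurability

lemma volume_rectangle {A B : Set ℝ} (hA : MeasurableSet A) (hB : MeasurableSet B) :
    volume {x : Plane | x 0 ∈ A ∧ x 1 ∈ B} = volume A * volume B := by
  have hset : {x : Plane | x 0 ∈ A ∧ x 1 ∈ B} =
      (fun x : Plane => WithLp.ofLp x) ⁻¹' (Set.pi univ ![A, B]) := by
    ext x
    simp [Set.mem_pi, Fin.forall_fin_two]
  have hm : MeasurableSet (Set.pi univ ![A, B]) :=
    MeasurableSet.univ_pi fun i => by fin_cases i <;> simpa
  rw [hset, (PiLp.volume_preserving_ofLp (Fin 2)).measure_preimage hm.nullMeasurableSet,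
    volume_pi_pi]
  simp

lemma deltah_one_fEps (ε : ℝ) (h x : Plane) :
    deltah univ 1 h (fEps ε) x = fEps ε (x + h) - fEps ε x := by
  simp [deltah, Finset.sum_range_succ]
  ring

lemma enorm_deltah_one_fEps (ε : ℝ) (h x : Plane) :
    ‖deltah univ 1 h (fEps ε) x‖ₑ =
      ‖(exitSet ε h ∪ (· + h) ⁻¹' exitSet ε (-h)).indicator (fun _ => (1 : ℝ)) x‖ₑ := by
  rw [deltah_one_fEps]
  by_cases h₁ : x 0 ∈ Icc 0 ε ∧ x 1 ∈ Icc 0 1 <;>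
    by_cases h₂ : x 0 + h 0 ∈ Icc 0 ε ∧ x 1 + h 1 ∈ Icc 0 1 <;>
    simp [fEps, exitSet, indicator, -mem_Icc, -not_and, h₁, h₂]

lemma lpNormE_deltah_one_fEps_rpow {τ : ℝ} (hτ : 0 < τ) (ε : ℝ) (h : Plane) :
    lpNormE τ univ (deltah univ 1 h (fEps ε)) ^ τ =
      volume (exitSet ε h ∪ (· + h) ⁻¹' exitSet ε (-h)) := by
  have hm : MeasurableSet (exitSet ε h ∪ (· + h) ⁻¹' exitSet ε (-h)) :=
    (measurableSet_exitSet ε h).union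
      ((measurable_add_const h) (measurableSet_exitSet ε (-h)))
  rw [lpNormE, Measure.restrict_univ,
    eLpNorm_congr_enorm_ae (.of_forall (enorm_deltah_one_fEps ε h)),
    eLpNorm_indicator_const hm (by simpa using hτ) ofReal_ne_top, ENNReal.toReal_ofReal hτ.le,
    enorm_one, one_mul, ← ENNReal.rpow_mul, one_div_mul_cancel hτ.ne', ENNReal.rpow_one]

lemma volume_exitSet_le {ε t : ℝ} (hε : 0 < ε) (hε₁ : ε ≤ 1) {h : Plane} (ht : ‖h‖ ≤ t) :
    volume (exitSet ε h) ≤ ENNReal.ofReal (4 * min t ε) := by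
  have hcoord : ∀ i, |h i| ≤ t := fun i => (PiLp.norm_apply_le h i).trans ht
  obtain ⟨h₀, h₀'⟩ := abs_le.1 (hcoord 0)
  obtain ⟨h₁, h₁'⟩ := abs_le.1 (hcoord 1)
  rcases le_total t ε with hle | hle
  · rw [min_eq_left hle]
    have hsub : exitSet ε h ⊆
        (({x | x 0 ∈ Icc 0 t ∧ x 1 ∈ Icc 0 1} ∪ {x | x 0 ∈ Icc (ε - t) ε ∧ x 1 ∈ Icc 0 1}) ∪
          {x | x 0 ∈ Icc 0 ε ∧ x 1 ∈ Icc 0 t}) ∪ {x | x 0 ∈ Icc 0 ε ∧ x 1 ∈ Icc (1 - t) 1} := by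
      rintro x ⟨⟨⟨ha, hb⟩, hc, hd⟩, hx⟩
      simp only [mem_union, mem_ofPred_eq, mem_Icc]
      by_contra! hcon
      obtain ⟨⟨⟨p, q⟩, r⟩, s⟩ := hcon
      apply hx
      simp only [mem_Icc]
      grind
    refine (measure_mono hsub).trans ((measure_union_le _ _).trans ?_)
    refine (add_le_add_left ((measure_union_le _ _).trans
      (add_le_add_left (measure_union_le _ _) _)) _).trans ?_
    simp only [volume_rectangle measurableSet_Icc measurableSet_Icc, Real.volume_Icc]
    have hεt : ENNReal.ofReal ε * ENNReal.ofReal t ≤ ENNReal.ofReal t := by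
      simpa using mul_le_mul_left (ENNReal.ofReal_le_ofReal hε₁) (ENNReal.ofReal t)
    calc _ = ENNReal.ofReal t + ENNReal.ofReal t + ENNReal.ofReal ε * ENNReal.ofReal t
          + ENNReal.ofReal ε * ENNReal.ofReal t := by simp
      _ ≤ ENNReal.ofReal t + ENNReal.ofReal t + ENNReal.ofReal t + ENNReal.ofReal t := by gcongr
      _ = ENNReal.ofReal (4 * t) := by
        rw [ENNReal.ofReal_mul (by norm_num), ENNReal.ofReal_ofNat]
        ring
  · rw [min_eq_right hle]
    calc volume (exitSet ε h) ≤ volume {x : Plane | x 0 ∈ Icc 0 ε ∧ x 1 ∈ Icc 0 1} :=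
          measure_mono fun x hx => hx.1
      _ = ENNReal.ofReal ε := by
        simp [volume_rectangle measurableSet_Icc measurableSet_Icc, -mem_Icc]
      _ ≤ _ := ENNReal.ofReal_le_ofReal (by linarith)

lemma le_volume_exitSet_single {ε s : ℝ} (hsε : s ≤ ε) :
    ENNReal.ofReal s ≤ volume (exitSet ε (EuclideanSpace.single 0 s)) := by
  calc ENNReal.ofReal s = volume {x : Plane | x 0 ∈ Ioc (ε - s) ε ∧ x 1 ∈ Icc 0 1} := by
        rw [volume_rectangle measurableSet_Ioc measurableSet_Icc]
        simp
    _ ≤ _ := by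
        refine measure_mono ?_
        rintro x ⟨⟨ha, hb⟩, hc⟩
        refine ⟨⟨⟨by linarith, hb⟩, hc⟩, fun hx => ?_⟩
        have := hx.1.2
        simp only [PiLp.single_apply, if_true] at this
        linarith

/-- **Two-sided estimate for the first modulus of smoothness of the characteristic function
of the thin rectangle `[0,ε]×[0,1]`: `ω₁(f_ε,t)_τ^τ ∼ min(t,ε)`.** -/
theorem modulus_elongated_indicator (τ : ℝ) (hτ : 0 < τ) :
    ∃ c₁ c₂ : ℝ, 0 < c₁ ∧ 0 < c₂ ∧
      ∀ t ε : ℝ, 0 < t → 0 < ε → ε ≤ 1 →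
        ENNReal.ofReal (c₁ * min t ε) ≤ modulus Set.univ 1 τ (fEps ε) t ^ τ ∧
          modulus Set.univ 1 τ (fEps ε) t ^ τ ≤ ENNReal.ofReal (c₂ * min t ε) := by
  refine ⟨1, 8, one_pos, by norm_num, fun t ε ht hε hε₁ => ⟨?_, ?_⟩⟩
  · have hs : 0 ≤ min t ε := le_min ht.le hε.le
    have hnorm : ‖(EuclideanSpace.single 0 (min t ε) : Plane)‖ ≤ t := by
      simp [abs_of_nonneg hs]
    calc ENNReal.ofReal (1 * min t ε)
        ≤ volume (exitSet ε (EuclideanSpace.single 0 (min t ε))) := by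
          simpa using le_volume_exitSet_single (min_le_right t ε)
      _ ≤ _ := measure_mono subset_union_left
      _ = _ := (lpNormE_deltah_one_fEps_rpow hτ ε _).symm
      _ ≤ _ := ENNReal.rpow_le_rpow
          (le_iSup₂ (f := fun (h : Plane) (_ : ‖h‖ ≤ t) =>
            lpNormE τ univ (deltah univ 1 h (fEps ε))) _ hnorm) hτ.le
  · rw [← ENNReal.le_rpow_inv_iff hτ]
    refine iSup₂_le fun h hh => ?_
    rw [ENNReal.le_rpow_inv_iff hτ, lpNormE_deltah_one_fEps_rpow hτ]
    have hs : 0 ≤ 4 * min t ε := mul_nonneg (by norm_num) (le_min ht.le hε.le)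
    calc _ ≤ volume (exitSet ε h) + volume ((· + h) ⁻¹' exitSet ε (-h)) := measure_union_le _ _
      _ = volume (exitSet ε h) + volume (exitSet ε (-h)) := by rw [measure_preimage_add_right]
      _ ≤ ENNReal.ofReal (4 * min t ε) + ENNReal.ofReal (4 * min t ε) :=
          add_le_add (volume_exitSet_le hε hε₁ hh)
            (volume_exitSet_le hε hε₁ (by rwa [norm_neg]))
      _ = ENNReal.ofReal (8 * min t ε) := by
          rw [← ENNReal.ofReal_add hs hs]
          congr 1
          ring

end
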